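/- arXiv:1907.11147 — 5 statements merged into one kernel-verified Lean document; each statement's English description precedes it below -/
import Mathlib

section
/- Let α > 0 satisfy tan(α) = −tanh(α), and define u : ℝ² → ℝ by u(x,y) = cos(αx)·cosh(αy). Then u is harmonic on ℝ², and u satisfies the Steklov boundary condition with eigenvalue λ = α·tanh(α) on the whole boundary of the square Q: for all y ∈ [−1,1], ∂₁u(1,y) = λ·u(1,y) and −∂₁u(−1,y) = λ·u(−1,y), and for all x ∈ [−1,1], ∂₂u(x,1) = λ·u(x,1) and −∂₂u(x,−1) = λ·u(x,−1). -/
/-- Partial derivative of `u : ℝ × ℝ → ℝ` with respect to the first coordinate. -/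
noncomputable def pd1 (u : ℝ × ℝ → ℝ) (p : ℝ × ℝ) : ℝ := deriv (fun x => u (x, p.2)) p.1

/-- Partial derivative of `u : ℝ × ℝ → ℝ` with respect to the second coordinate. -/
noncomputable def pd2 (u : ℝ × ℝ → ℝ) (p : ℝ × ℝ) : ℝ := deriv (fun y => u (p.1, y)) p.2

/-- `u` is harmonic on all of `ℝ²`: twice continuously differentiable with
`∂²u/∂x₁² + ∂²u/∂x₂² = 0` everywhere. -/
def Harmonic2 (u : ℝ × ℝ → ℝ) : Prop :=
  ContDiff ℝ 2 u ∧ ∀ p : ℝ × ℝ, pd1 (pd1 u) p + pd2 (pd2 u) p = 0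

theorem hasDerivAt_cos_const_mul (a x : ℝ) :
    HasDerivAt (fun t => Real.cos (a * t)) (-(a * Real.sin (a * x))) x := by
  convert ((hasDerivAt_id' x).const_mul a).cos using 1
  ring

theorem hasDerivAt_sin_const_mul (a x : ℝ) :
    HasDerivAt (fun t => Real.sin (a * t)) (a * Real.cos (a * x)) x := by
  convert ((hasDerivAt_id' x).const_mul a).sin using 1
  ring

theorem hasDerivAt_cosh_const_mul (a x : ℝ) :
    HasDerivAt (fun t => Real.cosh (a * t)) (a * Real.sinh (a * x)) x := by
  convert ((hasDerivAt_id' x).const_mul a).cosh using 1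
  ring

theorem hasDerivAt_sinh_const_mul (a x : ℝ) :
    HasDerivAt (fun t => Real.sinh (a * t)) (a * Real.cosh (a * x)) x := by
  convert ((hasDerivAt_id' x).const_mul a).sinh using 1
  ring

theorem pd1_cos_mul_cosh (a : ℝ) :
    pd1 (fun p => Real.cos (a * p.1) * Real.cosh (a * p.2)) =
      fun p => -(a * Real.sin (a * p.1)) * Real.cosh (a * p.2) :=
  funext fun p => ((hasDerivAt_cos_const_mul a p.1).mul_const (Real.cosh (a * p.2))).deriv

theorem pd2_cos_mul_cosh (a : ℝ) :
    pd2 (fun p => Real.cos (a * p.1) * Real.cosh (a * p.2)) =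
      fun p => Real.cos (a * p.1) * (a * Real.sinh (a * p.2)) :=
  funext fun p => ((hasDerivAt_cosh_const_mul a p.2).const_mul (Real.cos (a * p.1))).deriv

theorem harmonic2_cos_mul_cosh (a : ℝ) :
    Harmonic2 (fun p => Real.cos (a * p.1) * Real.cosh (a * p.2)) := by
  refine ⟨?_, fun p => ?_⟩
  · exact (Real.contDiff_cos.comp (contDiff_const.mul contDiff_fst)).mul
      (Real.contDiff_cosh.comp (contDiff_const.mul contDiff_snd))
  · have h₁ := (((hasDerivAt_sin_const_mul a p.1).const_mul a).neg.mul_const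
      (Real.cosh (a * p.2))).deriv
    have h₂ := (((hasDerivAt_sinh_const_mul a p.2).const_mul a).const_mul
      (Real.cos (a * p.1))).deriv
    rw [pd1_cos_mul_cosh, pd2_cos_mul_cosh]
    refine (congrArg₂ (· + ·) h₁ h₂).trans ?_
    ring

/-- The cosine of a positive solution of `tan α = -tanh α` is nonzero, so the equation can be
cleared of the denominator `cos α`. -/
theorem sin_eq_neg_tanh_mul_cos {α : ℝ} (hα : 0 < α) (htan : Real.tan α = -Real.tanh α) :
    Real.sin α = -Real.tanh α * Real.cos α := by
  have hcos : Real.cos α ≠ 0 := by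
    intro h
    have htanh : 0 < Real.tanh α := by
      rw [Real.tanh_eq_sinh_div_cosh]
      exact div_pos (Real.sinh_pos_iff.2 hα) (Real.cosh_pos α)
    rw [Real.tan_eq_sin_div_cos, h, div_zero] at htan
    linarith
  rw [← htan, Real.tan_mul_cos hcos]

/-- If `tan α = -tanh α` with `α > 0`, then `u(x,y) = cos(αx)·cosh(αy)` is harmonic on `ℝ²`
and satisfies the Steklov boundary condition with eigenvalue `λ = α·tanh α` on the whole
boundary of the square `(-1,1) × (-1,1)`. -/
theorem steklov_square_cos_cosh (α : ℝ) (hα : 0 < α)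
    (htan : Real.tan α = -Real.tanh α)
    (u : ℝ × ℝ → ℝ) (hu : u = fun p => Real.cos (α * p.1) * Real.cosh (α * p.2))
    (lam : ℝ) (hlam : lam = α * Real.tanh α) :
    Harmonic2 u ∧
      (∀ y ∈ Set.Icc (-1 : ℝ) 1,
        pd1 u (1, y) = lam * u (1, y) ∧ -pd1 u (-1, y) = lam * u (-1, y)) ∧
      (∀ x ∈ Set.Icc (-1 : ℝ) 1,
        pd2 u (x, 1) = lam * u (x, 1) ∧ -pd2 u (x, -1) = lam * u (x, -1)) := by
  subst hu hlam
  have hsin := sin_eq_neg_tanh_mul_cos hα htan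
  have hsinh : Real.sinh α = Real.tanh α * Real.cosh α := by
    rw [Real.tanh_eq_sinh_div_cosh, div_mul_cancel₀ _ (Real.cosh_pos α).ne']
  refine ⟨harmonic2_cos_mul_cosh α, fun y _ => ?_, fun x _ => ?_⟩
  · simp only [pd1_cos_mul_cosh, mul_neg, mul_one, Real.sin_neg, Real.cos_neg, hsin]
    constructor <;> ring
  · simp only [pd2_cos_mul_cosh, mul_neg, mul_one, Real.sinh_neg, Real.cosh_neg, hsinh]
    constructor <;> ring
end

section
/- Let α > 0 satisfy tan(α) = coth(α), and define u : ℝ² → ℝ by u(x,y) = sin(αx)·cosh(αy). Then u is harmonic on ℝ², and u satisfies the Steklov boundary condition with eigenvalue λ = α·tanh(α) on the whole boundary of the square Q: for all y ∈ [−1,1], ∂₁u(1,y) = λ·u(1,y) and −∂₁u(−1,y) = λ·u(−1,y), and for all x ∈ [−1,1], ∂₂u(x,1) = λ·u(x,1) and −∂₂u(x,−1) = λ·u(x,−1). -/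
theorem pd1_mul {f g f' : ℝ → ℝ} (hf : ∀ x, HasDerivAt f (f' x) x) :
    pd1 (fun p => f p.1 * g p.2) = fun p => f' p.1 * g p.2 :=
  funext fun p => ((hf p.1).mul_const (g p.2)).deriv

theorem pd2_mul {f g g' : ℝ → ℝ} (hg : ∀ y, HasDerivAt g (g' y) y) :
    pd2 (fun p => f p.1 * g p.2) = fun p => f p.1 * g' p.2 :=
  funext fun p => ((hg p.2).const_mul (f p.1)).deriv

theorem cos_eq_tanh_mul_sin {α : ℝ} (hα : 0 < α)
    (htan : Real.tan α = Real.cosh α / Real.sinh α) :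
    Real.cos α = Real.tanh α * Real.sin α := by
  have hs : 0 < Real.sinh α := Real.sinh_pos_iff.2 hα
  have hc : 0 < Real.cosh α := Real.cosh_pos α
  have hcos : Real.cos α ≠ 0 := by
    intro h
    have hpos : 0 < Real.tan α := htan ▸ div_pos hc hs
    simp [Real.tan_eq_sin_div_cos, h] at hpos
  rw [Real.tan_eq_sin_div_cos, div_eq_div_iff hcos hs.ne'] at htan
  rw [Real.tanh_eq_sinh_div_cosh, div_mul_eq_mul_div, eq_div_iff hc.ne']
  linarith

/-- If `tan α = coth α` with `α > 0`, then `u(x,y) = sin(αx)·cosh(αy)` is harmonic on `ℝ²`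
and satisfies the Steklov boundary condition with eigenvalue `λ = α·tanh α` on the whole
boundary of the square `(-1,1) × (-1,1)`. -/
theorem steklov_square_sin_cosh (α : ℝ) (hα : 0 < α)
    (htan : Real.tan α = Real.cosh α / Real.sinh α)
    (u : ℝ × ℝ → ℝ) (hu : u = fun p => Real.sin (α * p.1) * Real.cosh (α * p.2))
    (lam : ℝ) (hlam : lam = α * Real.tanh α) :
    Harmonic2 u ∧
      (∀ y ∈ Set.Icc (-1 : ℝ) 1,
        pd1 u (1, y) = lam * u (1, y) ∧ -pd1 u (-1, y) = lam * u (-1, y)) ∧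
      (∀ x ∈ Set.Icc (-1 : ℝ) 1,
        pd2 u (x, 1) = lam * u (x, 1) ∧ -pd2 u (x, -1) = lam * u (x, -1)) := by
  have hlin (t : ℝ) : HasDerivAt (fun x => α * x) α t := by
    simpa using (hasDerivAt_id t).const_mul α
  have hsin (t : ℝ) : HasDerivAt (fun x => Real.sin (α * x)) (Real.cos (α * t) * α) t :=
    (hlin t).sin
  have hcos (t : ℝ) : HasDerivAt (fun x => Real.cos (α * x) * α)
      (-Real.sin (α * t) * α * α) t := (hlin t).cos.mul_const α
  have hcosh (t : ℝ) : HasDerivAt (fun x => Real.cosh (α * x)) (Real.sinh (α * t) * α) t :=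
    (hlin t).cosh
  have hsinh (t : ℝ) : HasDerivAt (fun x => Real.sinh (α * x) * α)
      (Real.cosh (α * t) * α * α) t := (hlin t).sinh.mul_const α
  have h1 : pd1 u = fun p => Real.cos (α * p.1) * α * Real.cosh (α * p.2) := by
    rw [hu]
    exact pd1_mul (g := fun y => Real.cosh (α * y)) hsin
  have h2 : pd2 u = fun p => Real.sin (α * p.1) * (Real.sinh (α * p.2) * α) := by
    rw [hu]
    exact pd2_mul (f := fun x => Real.sin (α * x)) hcosh
  have h11 : pd1 (pd1 u) = fun p => -Real.sin (α * p.1) * α * α * Real.cosh (α * p.2) := by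
    rw [h1]
    exact pd1_mul (g := fun y => Real.cosh (α * y)) hcos
  have h22 : pd2 (pd2 u) = fun p => Real.sin (α * p.1) * (Real.cosh (α * p.2) * α * α) := by
    rw [h2]
    exact pd2_mul (f := fun x => Real.sin (α * x)) hsinh
  have hbd1 := cos_eq_tanh_mul_sin hα htan
  have hbd2 : Real.sinh α = Real.tanh α * Real.cosh α := by
    rw [Real.tanh_eq_sinh_div_cosh, div_mul_cancel₀ _ (Real.cosh_pos α).ne']
  refine ⟨⟨?_, fun p => ?_⟩, fun y _ => ?_, fun x _ => ?_⟩
  · rw [hu]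
    fun_prop
  · rw [h11, h22]
    ring
  · rw [h1]
    simp only [hu, hlam, mul_neg, mul_one, Real.cos_neg, Real.sin_neg, hbd1]
    constructor <;> ring
  · rw [h2]
    simp only [hu, hlam, mul_neg, mul_one, Real.cosh_neg, Real.sinh_neg, hbd2]
    constructor <;> ring
end

section
/- Let α > 0 satisfy tan(α) = tanh(α), and define u : ℝ² → ℝ by u(x,y) = sin(αx)·sinh(αy). Then u is harmonic on ℝ², and u satisfies the Steklov boundary condition with eigenvalue λ = α·coth(α) on the whole boundary of the square Q: for all y ∈ [−1,1], ∂₁u(1,y) = λ·u(1,y) and −∂₁u(−1,y) = λ·u(−1,y), and for all x ∈ [−1,1], ∂₂u(x,1) = λ·u(x,1) and −∂₂u(x,−1) = λ·u(x,−1). -/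
theorem pd1_sin_mul (α : ℝ) (g : ℝ → ℝ) :
    pd1 (fun p => Real.sin (α * p.1) * g p.2) = fun p => α * Real.cos (α * p.1) * g p.2 := by
  funext p
  have h : HasDerivAt (fun x => α * x) α p.1 := by
    simpa using (hasDerivAt_id p.1).const_mul α
  exact (h.sin.mul_const (g p.2)).deriv.trans (by ring)

theorem pd1_mul_cos_mul (α : ℝ) (g : ℝ → ℝ) :
    pd1 (fun p => α * Real.cos (α * p.1) * g p.2) =
      fun p => -(α ^ 2 * Real.sin (α * p.1) * g p.2) := by
  funext p
  have h : HasDerivAt (fun x => α * x) α p.1 := by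
    simpa using (hasDerivAt_id p.1).const_mul α
  exact ((h.cos.const_mul α).mul_const (g p.2)).deriv.trans (by ring)

theorem pd2_mul_sinh (α : ℝ) (f : ℝ → ℝ) :
    pd2 (fun p => f p.1 * Real.sinh (α * p.2)) = fun p => f p.1 * (α * Real.cosh (α * p.2)) := by
  funext p
  have h : HasDerivAt (fun y => α * y) α p.2 := by
    simpa using (hasDerivAt_id p.2).const_mul α
  exact (h.sinh.const_mul (f p.1)).deriv.trans (by ring)

theorem pd2_mul_mul_cosh (α : ℝ) (f : ℝ → ℝ) :
    pd2 (fun p => f p.1 * (α * Real.cosh (α * p.2))) =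
      fun p => f p.1 * (α ^ 2 * Real.sinh (α * p.2)) := by
  funext p
  have h : HasDerivAt (fun y => α * y) α p.2 := by
    simpa using (hasDerivAt_id p.2).const_mul α
  exact ((h.cosh.const_mul α).const_mul (f p.1)).deriv.trans (by ring)

theorem sin_mul_cosh_eq_sinh_mul_cos {α : ℝ} (hα : 0 < α) (htan : Real.tan α = Real.tanh α) :
    Real.sin α * Real.cosh α = Real.sinh α * Real.cos α := by
  have hsinh : 0 < Real.sinh α := Real.sinh_pos_iff.2 hα
  have hcosh : 0 < Real.cosh α := Real.cosh_pos α
  rw [Real.tan_eq_sin_div_cos, Real.tanh_eq_sinh_div_cosh] at htan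
  have hcos : Real.cos α ≠ 0 := by
    intro h
    rw [h, div_zero] at htan
    exact (div_pos hsinh hcosh).ne htan
  exact (div_eq_div_iff hcos hcosh.ne').1 htan

/-- If `tan α = tanh α` with `α > 0`, then `u(x,y) = sin(αx)·sinh(αy)` is harmonic on `ℝ²`
and satisfies the Steklov boundary condition with eigenvalue `λ = α·coth α` on the whole
boundary of the square `(-1,1) × (-1,1)`. -/
theorem steklov_square_sin_sinh (α : ℝ) (hα : 0 < α)
    (htan : Real.tan α = Real.tanh α)
    (u : ℝ × ℝ → ℝ) (hu : u = fun p => Real.sin (α * p.1) * Real.sinh (α * p.2))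
    (lam : ℝ) (hlam : lam = α * (Real.cosh α / Real.sinh α)) :
    Harmonic2 u ∧
      (∀ y ∈ Set.Icc (-1 : ℝ) 1,
        pd1 u (1, y) = lam * u (1, y) ∧ -pd1 u (-1, y) = lam * u (-1, y)) ∧
      (∀ x ∈ Set.Icc (-1 : ℝ) 1,
        pd2 u (x, 1) = lam * u (x, 1) ∧ -pd2 u (x, -1) = lam * u (x, -1)) := by
  subst hu hlam
  have hsinh : Real.sinh α ≠ 0 := (Real.sinh_pos_iff.2 hα).ne'
  have key := sin_mul_cosh_eq_sinh_mul_cos hα htan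
  have hcos : α * Real.cos α = α * (Real.cosh α / Real.sinh α) * Real.sin α := by
    field_simp
    linarith
  have hcosh : α * Real.cosh α = α * (Real.cosh α / Real.sinh α) * Real.sinh α := by
    field_simp
  have hpd1 := pd1_sin_mul α (fun y => Real.sinh (α * y))
  have hpd2 := pd2_mul_sinh α (fun x => Real.sin (α * x))
  refine ⟨⟨?_, fun p => ?_⟩, fun y _ => ?_, fun x _ => ?_⟩
  · exact (contDiff_const.mul contDiff_fst).sin.mul (contDiff_const.mul contDiff_snd).sinh
  · rw [hpd1, hpd2, pd1_mul_cos_mul α (fun y => Real.sinh (α * y)),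
      pd2_mul_mul_cosh α (fun x => Real.sin (α * x))]
    ring
  · rw [hpd1]
    simp only [mul_one, mul_neg, Real.cos_neg, Real.sin_neg, hcos]
    constructor <;> ring
  · rw [hpd2]
    simp only [mul_one, mul_neg, Real.cosh_neg, Real.sinh_neg, hcosh]
    constructor <;> ring
end

section
/- Let Γ_S ⊆ S¹ be a Borel measurable subset of the unit circle and let Γ_Δ ⊆ Γ_S be Borel measurable. Let λ⁰, λ^ε ∈ ℝ, and let u⁰, u^ε : ℝ² → ℝ be continuously differentiable on an open neighborhood of the closed unit disk and harmonic on the open unit disk D. Assume the boundary conditions: p · ∇u⁰(p) = λ⁰ · u⁰(p) for all p ∈ Γ_S and p · ∇u⁰(p) = 0 for all p ∈ S¹ \ Γ_S; and p · ∇u^ε(p) = λ^ε · u^ε(p) for all p ∈ Γ_S \ Γ_Δ and p · ∇u^ε(p) = 0 for all p ∈ (S¹ \ Γ_S) ∪ Γ_Δ. Then (λ^ε − λ⁰) · ∫_{Γ_S \ Γ_Δ} u⁰ u^ε dσ = λ⁰ · ∫_{Γ_Δ} u⁰ u^ε dσ. -/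
open MeasureTheory Metric

/-- The Laplacian `∂²u/∂x₁² + ∂²u/∂x₂²` of `u : ℝ² → ℝ` at a point `p`. -/
noncomputable def laplacian2 (u : EuclideanSpace ℝ (Fin 2) → ℝ)
    (p : EuclideanSpace ℝ (Fin 2)) : ℝ :=
  ∑ i : Fin 2,
    fderiv ℝ (fun x => fderiv ℝ u x (EuclideanSpace.single i (1 : ℝ))) p
      (EuclideanSpace.single i (1 : ℝ))

/-- `u` is harmonic on an open set `U ⊆ ℝ²`: it is twice continuously differentiable
on `U` and its Laplacian vanishes at every point of `U`. -/
def IsHarmonicOn (u : EuclideanSpace ℝ (Fin 2) → ℝ)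
    (U : Set (EuclideanSpace ℝ (Fin 2))) : Prop :=
  ContDiffOn ℝ 2 u U ∧ ∀ p ∈ U, laplacian2 u p = 0

/-- Rotation of the plane by a quarter turn. -/
noncomputable def quarterTurn (x : EuclideanSpace ℝ (Fin 2)) : EuclideanSpace ℝ (Fin 2) :=
  !₂[-x 1, x 0]

/-- Rotation of the plane by the angle `θ`. -/
noncomputable def planeRotation (θ : ℝ) (x : EuclideanSpace ℝ (Fin 2)) :
    EuclideanSpace ℝ (Fin 2) :=
  Real.cos θ • x + Real.sin θ • quarterTurn x

lemma norm_planeRotation (θ : ℝ) (x : EuclideanSpace ℝ (Fin 2)) :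
    ‖planeRotation θ x‖ = ‖x‖ := by
  simp only [EuclideanSpace.norm_eq, Fin.sum_univ_two, planeRotation, quarterTurn, Real.norm_eq_abs,
    sq_abs]
  congr 1
  simp
  linear_combination (x 0 ^ 2 + x 1 ^ 2) * Real.sin_sq_add_cos_sq θ

lemma planeRotation_planeRotation_neg (θ : ℝ) (x : EuclideanSpace ℝ (Fin 2)) :
    planeRotation θ (planeRotation (-θ) x) = x := by
  ext i
  fin_cases i <;> simp [planeRotation, quarterTurn]
  · linear_combination x 0 * Real.sin_sq_add_cos_sq θ
  · linear_combination x 1 * Real.sin_sq_add_cos_sq θ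

lemma isometry_planeRotation (θ : ℝ) : Isometry (planeRotation θ) := by
  refine Isometry.of_dist_eq fun x y => ?_
  rw [dist_eq_norm, dist_eq_norm, ← norm_planeRotation θ (x - y)]
  congr 1
  ext i
  fin_cases i <;> simp [planeRotation, quarterTurn] <;> ring

lemma quarterTurn_planeRotation (θ : ℝ) (x : EuclideanSpace ℝ (Fin 2)) :
    quarterTurn (planeRotation θ x) = -Real.sin θ • x + Real.cos θ • quarterTurn x := by
  ext i
  fin_cases i <;> simp [planeRotation, quarterTurn] <;> ring

lemma continuous_quarterTurn : Continuous quarterTurn := by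
  unfold quarterTurn
  fun_prop

lemma continuous_planeRotation :
    Continuous fun x : EuclideanSpace ℝ (Fin 2) × ℝ => planeRotation x.2 x.1 := by
  unfold planeRotation
  have := continuous_quarterTurn
  fun_prop

lemma hasDerivAt_planeRotation (p : EuclideanSpace ℝ (Fin 2)) (θ : ℝ) :
    HasDerivAt (fun t => planeRotation t p) (quarterTurn (planeRotation θ p)) θ := by
  rw [quarterTurn_planeRotation]
  exact ((Real.hasDerivAt_cos θ).smul_const p).add
    ((Real.hasDerivAt_sin θ).smul_const (quarterTurn p))

lemma hasDerivAt_quarterTurn_planeRotation (p : EuclideanSpace ℝ (Fin 2)) (θ : ℝ) :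
    HasDerivAt (fun t => quarterTurn (planeRotation t p)) (-planeRotation θ p) θ := by
  simp only [quarterTurn_planeRotation]
  rw [planeRotation, neg_add, ← neg_smul, ← neg_smul]
  exact ((Real.hasDerivAt_sin θ).neg.smul_const p).add
    ((Real.hasDerivAt_cos θ).smul_const (quarterTurn p))

/-- The trace of a bilinear form on the plane can be computed in the orthonormal basis obtained
from a unit vector and its quarter turn. -/
lemma apply_self_add_apply_quarterTurn
    (L : EuclideanSpace ℝ (Fin 2) →L[ℝ] EuclideanSpace ℝ (Fin 2) →L[ℝ] ℝ)
    {x : EuclideanSpace ℝ (Fin 2)} (hx : ‖x‖ = 1) :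
    L x x + L (quarterTurn x) (quarterTurn x) =
      ∑ i : Fin 2, L (EuclideanSpace.single i 1) (EuclideanSpace.single i 1) := by
  have h1 : x = x 0 • EuclideanSpace.single 0 (1 : ℝ) + x 1 • EuclideanSpace.single 1 (1 : ℝ) := by
    ext i
    fin_cases i <;> simp
  have h2 : quarterTurn x =
      (-x 1) • EuclideanSpace.single 0 (1 : ℝ) + x 0 • EuclideanSpace.single 1 (1 : ℝ) := by
    ext i
    fin_cases i <;> simp [quarterTurn]
  have h3 : x 0 ^ 2 + x 1 ^ 2 = 1 := by
    have := EuclideanSpace.norm_sq_eq x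
    rw [hx, Fin.sum_univ_two, Real.norm_eq_abs, Real.norm_eq_abs, sq_abs, sq_abs] at this
    linarith
  rw [h2]
  generalize x 0 = a at *
  generalize x 1 = b at *
  subst h1
  simp only [map_add, map_smul, add_apply, smul_apply,
    smul_eq_mul, Fin.sum_univ_two]
  linear_combination (L (EuclideanSpace.single 0 1) (EuclideanSpace.single 0 1)
    + L (EuclideanSpace.single 1 1) (EuclideanSpace.single 1 1)) * h3

/-- The flux through the unit circle of a divergence-free field of covectors vanishes. -/
lemma integral_planeRotation_eq_zero
    {W : EuclideanSpace ℝ (Fin 2) → EuclideanSpace ℝ (Fin 2) →L[ℝ] ℝ}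
    (hc : ContinuousOn W (closedBall 0 1)) (hd : DifferentiableOn ℝ W (ball 0 1))
    (hdiv : ∀ x ∈ ball (0 : EuclideanSpace ℝ (Fin 2)) 1,
      ∑ i : Fin 2, fderiv ℝ W x (EuclideanSpace.single i 1) (EuclideanSpace.single i 1) = 0)
    {p : EuclideanSpace ℝ (Fin 2)} (hp : ‖p‖ = 1) :
    ∫ θ in (0 : ℝ)..(2 * Real.pi), W (planeRotation θ p) (planeRotation θ p) = 0 := by
  classical
  set e : ℝ → EuclideanSpace ℝ (Fin 2) := fun θ => planeRotation θ p with he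
  have hen : ∀ θ, ‖e θ‖ = 1 := fun θ => (norm_planeRotation θ p).trans hp
  have hed : ∀ θ, HasDerivAt e (quarterTurn (e θ)) θ := hasDerivAt_planeRotation p
  have hJd : ∀ θ, HasDerivAt (fun t => quarterTurn (e t)) (-e θ) θ :=
    hasDerivAt_quarterTurn_planeRotation p
  have hediff : Differentiable ℝ e := fun θ => (hed θ).differentiableAt
  have hJdiff : Differentiable ℝ fun t => quarterTurn (e t) := fun θ => (hJd θ).differentiableAt
  have hec := hediff.continuous
  have hJc := hJdiff.continuous
  have hJsnd : Differentiable ℝ fun x : ℝ × ℝ => quarterTurn (e x.2) :=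
    hJdiff.comp differentiable_snd
  set f : ℝ × ℝ → ℝ := fun x => x.1 * W (x.1 • e x.2) (e x.2) with hf
  set g : ℝ × ℝ → ℝ := fun x => W (x.1 • e x.2) (quarterTurn (e x.2)) with hg
  set I : Set (ℝ × ℝ) := Set.Ioo (min 0 1) (max 0 1) ×ˢ
    Set.Ioo (min 0 (2 * Real.pi)) (max 0 (2 * Real.pi))
  have hmem : ∀ x ∈ I, x.1 • e x.2 ∈ ball (0 : EuclideanSpace ℝ (Fin 2)) 1 := by
    rintro ⟨r, θ⟩ ⟨hr, -⟩
    simp at hr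
    simp [norm_smul, hen, abs_of_pos hr.1, hr.2]
  have hWd : ∀ x ∈ I, DifferentiableAt ℝ W (x.1 • e x.2) := fun x hx =>
    hd.differentiableAt (isOpen_ball.mem_nhds (hmem x hx))
  have hcW : ContinuousOn (fun x : ℝ × ℝ => W (x.1 • e x.2))
      (Set.uIcc 0 1 ×ˢ Set.uIcc 0 (2 * Real.pi)) := by
    refine hc.comp (by fun_prop) ?_
    rintro ⟨r, θ⟩ ⟨hr, -⟩
    simp at hr
    simp [norm_smul, hen, abs_of_nonneg hr.1, hr.2]
  have hWcomp : ∀ x ∈ I, DifferentiableAt ℝ (fun x : ℝ × ℝ => W (x.1 • e x.2)) x := fun x hx =>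
    (hWd x hx).comp x (by fun_prop)
  have hfd : ∀ x ∈ I, DifferentiableAt ℝ f x := fun x hx =>
    differentiableAt_fst.mul ((hWcomp x hx).clm_apply (by fun_prop))
  have hgd : ∀ x ∈ I, DifferentiableAt ℝ g x := fun x hx =>
    (hWcomp x hx).clm_apply (hJsnd x)
  have hzero : ∀ x ∈ I, fderiv ℝ f x (1, 0) + fderiv ℝ g x (0, 1) = 0 := by
    rintro ⟨r, θ⟩ hx
    have hW := (hWd _ hx).hasFDerivAt
    have h1 : HasDerivAt (fun t => f (t, θ)) (fderiv ℝ f (r, θ) (1, 0)) r :=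
      (hfd _ hx).hasFDerivAt.comp_hasDerivAt (f := fun t : ℝ => (t, θ)) r
        ((hasDerivAt_id r).prodMk (hasDerivAt_const r θ))
    have h2 : HasDerivAt (fun t => g (r, t)) (fderiv ℝ g (r, θ) (0, 1)) θ :=
      (hgd _ hx).hasFDerivAt.comp_hasDerivAt (f := fun t : ℝ => (r, t)) θ
        ((hasDerivAt_const θ r).prodMk (hasDerivAt_id θ))
    have h3 := (hasDerivAt_id r).mul ((hW.comp_hasDerivAt (f := fun t : ℝ => t • e θ) r
      ((hasDerivAt_id r).smul_const (e θ))).clm_apply (hasDerivAt_const r (e θ)))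
    have h4 := (hW.comp_hasDerivAt (f := fun t : ℝ => r • e t) θ
      ((hed θ).const_smul r)).clm_apply (hJd θ)
    rw [h1.unique h3, h2.unique h4]
    have h5 := apply_self_add_apply_quarterTurn (fderiv ℝ W (r • e θ)) (hen θ)
    rw [hdiv _ (hmem _ hx)] at h5
    simp
    linear_combination r * h5
  have key := integral2_divergence_prod_of_hasFDerivAt f g
    (fun x => if x ∈ I then fderiv ℝ f x else 0) (fun x => if x ∈ I then fderiv ℝ g x else 0)
    0 0 1 (2 * Real.pi)
    (continuousOn_fst.mul (hcW.clm_apply (hec.comp continuous_snd).continuousOn))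
    (hcW.clm_apply hJsnd.continuous.continuousOn)
    (fun x hx => by
      rw [if_pos (show x ∈ I from hx)]
      exact (hfd x hx).hasFDerivAt)
    (fun x hx => by
      rw [if_pos (show x ∈ I from hx)]
      exact (hgd x hx).hasFDerivAt)
  have hz : ∀ x : ℝ × ℝ, (if x ∈ I then fderiv ℝ f x else 0) (1, 0) +
      (if x ∈ I then fderiv ℝ g x else 0) (0, 1) = 0 := by
    intro x
    split_ifs with h
    · exact hzero x h
    · simp
  simp only [hz] at key
  have key := key (by simp)
  have he2 : e (2 * Real.pi) = e 0 := by simp [he, planeRotation]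
  simpa [hf, hg, he2] using key.symm

lemma IsHarmonicOn.differentiableOn_fderiv {u : EuclideanSpace ℝ (Fin 2) → ℝ}
    {U : Set (EuclideanSpace ℝ (Fin 2))} (hU : IsOpen U) (hu : IsHarmonicOn u U) :
    DifferentiableOn ℝ (fderiv ℝ u) U :=
  (hu.1.fderiv_of_isOpen hU (m := 1) (by norm_num)).differentiableOn (by norm_num)

lemma IsHarmonicOn.sum_fderiv_fderiv {u : EuclideanSpace ℝ (Fin 2) → ℝ}
    {U : Set (EuclideanSpace ℝ (Fin 2))} (hU : IsOpen U) (hu : IsHarmonicOn u U)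
    {x : EuclideanSpace ℝ (Fin 2)} (hx : x ∈ U) :
    ∑ i : Fin 2, fderiv ℝ (fderiv ℝ u) x (EuclideanSpace.single i 1)
      (EuclideanSpace.single i 1) = 0 := by
  rw [← hu.2 x hx, laplacian2]
  refine Finset.sum_congr rfl fun i _ => ?_
  have h := (hu.differentiableOn_fderiv hU).differentiableAt (hU.mem_nhds hx)
  have h' := h.hasFDerivAt.clm_apply
    (hasFDerivAt_const (EuclideanSpace.single i (1 : ℝ) : EuclideanSpace ℝ (Fin 2)) x)
  rw [h'.fderiv]
  simp

/-- **Green's second identity** for harmonic functions on the unit disk. -/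
lemma integral_green_planeRotation {u v : EuclideanSpace ℝ (Fin 2) → ℝ}
    {V : Set (EuclideanSpace ℝ (Fin 2))} (hV : IsOpen V) (hVball : closedBall 0 1 ⊆ V)
    (huC : ContDiffOn ℝ 1 u V) (hvC : ContDiffOn ℝ 1 v V)
    (hu : IsHarmonicOn u (ball 0 1)) (hv : IsHarmonicOn v (ball 0 1))
    {p : EuclideanSpace ℝ (Fin 2)} (hp : ‖p‖ = 1) :
    ∫ θ in (0 : ℝ)..(2 * Real.pi),
      (u (planeRotation θ p) * fderiv ℝ v (planeRotation θ p) (planeRotation θ p) -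
        v (planeRotation θ p) * fderiv ℝ u (planeRotation θ p) (planeRotation θ p)) = 0 := by
  have hd : ∀ {w : EuclideanSpace ℝ (Fin 2) → ℝ}, IsHarmonicOn w (ball 0 1) →
      ∀ x ∈ ball (0 : EuclideanSpace ℝ (Fin 2)) 1,
        HasFDerivAt w (fderiv ℝ w x) x ∧ HasFDerivAt (fderiv ℝ w) (fderiv ℝ (fderiv ℝ w) x) x :=
    fun hw x hx =>
      ⟨((hw.1.differentiableOn (by norm_num)).differentiableAt
          (isOpen_ball.mem_nhds hx)).hasFDerivAt,
        ((hw.differentiableOn_fderiv isOpen_ball).differentiableAt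
          (isOpen_ball.mem_nhds hx)).hasFDerivAt⟩
  have hW := fun (x : EuclideanSpace ℝ (Fin 2)) (hx : x ∈ ball 0 1) =>
    ((hd hu x hx).1.smul (hd hv x hx).2).sub ((hd hv x hx).1.smul (hd hu x hx).2)
  refine integral_planeRotation_eq_zero (W := u • fderiv ℝ v - v • fderiv ℝ u)
    ?_ (fun x hx => (hW x hx).differentiableAt.differentiableWithinAt) (fun x hx => ?_) hp
  · have h1 := huC.continuousOn_fderiv_of_isOpen hV le_rfl
    have h2 := hvC.continuousOn_fderiv_of_isOpen hV le_rfl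
    exact ((huC.continuousOn.smul h2).sub (hvC.continuousOn.smul h1)).mono hVball
  · rw [(hW x hx).fderiv]
    have h1 := hu.sum_fderiv_fderiv isOpen_ball hx
    have h2 := hv.sum_fderiv_fderiv isOpen_ball hx
    simp only [Fin.sum_univ_two] at h1 h2 ⊢
    simp
    linear_combination u x * h2 - v x * h1

lemma hausdorffMeasure_sphere_lt_top :
    μH[1] (sphere (0 : EuclideanSpace ℝ (Fin 2)) 1) < ⊤ := by
  set p : EuclideanSpace ℝ (Fin 2) := EuclideanSpace.single 0 1 with hp
  have hsub : sphere (0 : EuclideanSpace ℝ (Fin 2)) 1 ⊆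
      (fun θ => planeRotation θ p) '' Set.Icc (-Real.pi) Real.pi := by
    intro x hx
    have hz : ‖(⟨x 0, x 1⟩ : ℂ)‖ = 1 := by
      have h := mem_sphere_zero_iff_norm.1 hx
      rw [EuclideanSpace.norm_eq, Fin.sum_univ_two, Real.norm_eq_abs, Real.norm_eq_abs, sq_abs,
        sq_abs] at h
      rw [Complex.norm_def, Complex.normSq_mk, ← h]
      congr 1
      ring
    refine ⟨Complex.arg ⟨x 0, x 1⟩, ⟨(Complex.neg_pi_lt_arg _).le, Complex.arg_le_pi _⟩, ?_⟩
    have hc := Complex.norm_mul_cos_arg ⟨x 0, x 1⟩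
    have hs := Complex.norm_mul_sin_arg ⟨x 0, x 1⟩
    rw [hz, one_mul] at hc hs
    ext i
    fin_cases i <;> simp [planeRotation, quarterTurn, hp, hc, hs]
  have hlip : LipschitzWith 1 fun θ => planeRotation θ p := by
    refine lipschitzWith_of_nnnorm_deriv_le
      (fun θ => (hasDerivAt_planeRotation p θ).differentiableAt) fun θ => ?_
    have h : ‖quarterTurn (planeRotation θ p)‖ = 1 := by
      have := norm_planeRotation (Real.pi / 2) (planeRotation θ p)
      rw [norm_planeRotation θ p] at this
      simpa [planeRotation, hp] using this
    rw [(hasDerivAt_planeRotation p θ).deriv, ← NNReal.coe_le_coe]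
    simp [h]
  refine (measure_mono hsub).trans_lt ((hlip.hausdorffMeasure_image_le zero_le_one _).trans_lt ?_)
  rw [hausdorffMeasure_real]
  simp

lemma setIntegral_sphere_comp_planeRotation (w : EuclideanSpace ℝ (Fin 2) → ℝ) (θ : ℝ) :
    ∫ p in sphere (0 : EuclideanSpace ℝ (Fin 2)) 1, w (planeRotation θ p) ∂(μH[1]) =
      ∫ p in sphere (0 : EuclideanSpace ℝ (Fin 2)) 1, w p ∂(μH[1]) := by
  have h := (IsometryEquiv.mk' (planeRotation θ) (planeRotation (-θ))
    (planeRotation_planeRotation_neg θ) (isometry_planeRotation θ)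
    ).measurePreserving_hausdorffMeasure 1
  have := h.setIntegral_preimage_emb
    (isometry_planeRotation θ).isClosedEmbedding.measurableEmbedding w (sphere 0 1)
  have hpre : planeRotation θ ⁻¹' sphere 0 1 = sphere 0 1 := by
    ext x
    simp [norm_planeRotation]
  rw [← this]
  change _ = ∫ p in planeRotation θ ⁻¹' sphere 0 1, w (planeRotation θ p) ∂(μH[1])
  rw [hpre]

/-- A continuous function on the unit circle whose integral along each parametrization of the
circle by rotations vanishes has zero integral for the Hausdorff measure. -/
lemma setIntegral_sphere_eq_zero {w : EuclideanSpace ℝ (Fin 2) → ℝ}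
    (hw : ContinuousOn w (sphere 0 1))
    (h0 : ∀ p : EuclideanSpace ℝ (Fin 2), ‖p‖ = 1 →
      ∫ θ in (0 : ℝ)..(2 * Real.pi), w (planeRotation θ p) = 0) :
    ∫ p in sphere (0 : EuclideanSpace ℝ (Fin 2)) 1, w p ∂(μH[1]) = 0 := by
  set S := sphere (0 : EuclideanSpace ℝ (Fin 2)) 1 with hS
  have hSm : MeasurableSet S := isClosed_sphere.measurableSet
  have hpi : (0 : ℝ) ≤ 2 * Real.pi := by positivity
  set σ : Measure (EuclideanSpace ℝ (Fin 2)) := (μH[1]).restrict S with hσ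
  have : IsFiniteMeasure σ := ⟨by simpa [hσ] using hausdorffMeasure_sphere_lt_top⟩
  have hint : Integrable (Function.uncurry fun (p : EuclideanSpace ℝ (Fin 2)) θ =>
      w (planeRotation θ p)) (σ.prod (volume.restrict (Set.Icc 0 (2 * Real.pi)))) := by
    have hc : ContinuousOn (Function.uncurry fun (p : EuclideanSpace ℝ (Fin 2)) θ =>
        w (planeRotation θ p)) (S ×ˢ Set.Icc 0 (2 * Real.pi)) := by
      refine hw.comp continuous_planeRotation.continuousOn ?_
      rintro ⟨p, θ⟩ ⟨hp, -⟩
      simpa [hS, norm_planeRotation] using hp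
    have hi := hc.integrableOn_compact (μ := σ.prod volume)
      ((isCompact_sphere _ _).prod isCompact_Icc)
    rwa [IntegrableOn, ← Measure.prod_restrict, hσ, Measure.restrict_restrict hSm,
      Set.inter_self] at hi
  have hswap := integral_integral_swap hint
  simp only [hσ, setIntegral_sphere_comp_planeRotation, hS] at hswap
  rw [setIntegral_congr_fun (g := fun _ => (0 : ℝ)) hSm] at hswap
  · simpa [hpi, Real.pi_ne_zero] using hswap
  · intro p hp
    have := h0 p (by simpa [hS] using hp)
    rw [intervalIntegral.integral_of_le hpi, ← integral_Icc_eq_integral_Ioc] at this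
    exact this

/-- Green's-identity relation between an unperturbed Steklov–Neumann eigenpair
`(λ⁰, u⁰)` for the partition `(Γ_S, S¹ \ Γ_S)` of the unit circle and a perturbed
eigenpair `(λ^ε, u^ε)` for the partition `(Γ_S \ Γ_Δ, (S¹ \ Γ_S) ∪ Γ_Δ)`:
`(λ^ε - λ⁰) ∫_{Γ_S \ Γ_Δ} u⁰ u^ε dσ = λ⁰ ∫_{Γ_Δ} u⁰ u^ε dσ`, where `σ = μH[1]` is the
one-dimensional Hausdorff measure, and on `S¹` the outward normal derivative of `u`
at `p` is the directional derivative `fderiv ℝ u p p`. -/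
theorem eigenvalue_perturbation_identity
    (ΓS ΓΔ : Set (EuclideanSpace ℝ (Fin 2)))
    (hΓSm : MeasurableSet ΓS) (hΓS : ΓS ⊆ sphere (0 : EuclideanSpace ℝ (Fin 2)) 1)
    (hΓΔm : MeasurableSet ΓΔ) (hΓΔ : ΓΔ ⊆ ΓS)
    (lam0 lamε : ℝ) (u0 uε : EuclideanSpace ℝ (Fin 2) → ℝ)
    (V : Set (EuclideanSpace ℝ (Fin 2))) (hV : IsOpen V)
    (hVball : closedBall (0 : EuclideanSpace ℝ (Fin 2)) 1 ⊆ V)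
    (hu0C1 : ContDiffOn ℝ 1 u0 V) (huεC1 : ContDiffOn ℝ 1 uε V)
    (hu0harm : IsHarmonicOn u0 (ball (0 : EuclideanSpace ℝ (Fin 2)) 1))
    (huεharm : IsHarmonicOn uε (ball (0 : EuclideanSpace ℝ (Fin 2)) 1))
    (hbc0S : ∀ p ∈ ΓS, fderiv ℝ u0 p p = lam0 * u0 p)
    (hbc0N : ∀ p ∈ sphere (0 : EuclideanSpace ℝ (Fin 2)) 1 \ ΓS, fderiv ℝ u0 p p = 0)
    (hbcεS : ∀ p ∈ ΓS \ ΓΔ, fderiv ℝ uε p p = lamε * uε p)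
    (hbcεN : ∀ p ∈ (sphere (0 : EuclideanSpace ℝ (Fin 2)) 1 \ ΓS) ∪ ΓΔ,
      fderiv ℝ uε p p = 0) :
    (lamε - lam0) * ∫ p in ΓS \ ΓΔ, u0 p * uε p ∂(μH[1]) =
      lam0 * ∫ p in ΓΔ, u0 p * uε p ∂(μH[1]) := by
  set S := sphere (0 : EuclideanSpace ℝ (Fin 2)) 1 with hS
  have hSV : S ⊆ V := sphere_subset_closedBall.trans hVball
  have hSm : MeasurableSet S := isClosed_sphere.measurableSet
  have hid : ContinuousOn (fun p : EuclideanSpace ℝ (Fin 2) => p) S := continuousOn_id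
  have hc0 := (hu0C1.continuousOn_fderiv_of_isOpen hV le_rfl).mono hSV
  have hcε := (huεC1.continuousOn_fderiv_of_isOpen hV le_rfl).mono hSV
  have hu0c := hu0C1.continuousOn.mono hSV
  have huεc := huεC1.continuousOn.mono hSV
  set w : EuclideanSpace ℝ (Fin 2) → ℝ :=
    fun p => u0 p * fderiv ℝ uε p p - uε p * fderiv ℝ u0 p p with hw
  have hwc : ContinuousOn w S :=
    (hu0c.mul (hcε.clm_apply hid)).sub (huεc.mul (hc0.clm_apply hid))
  have hflux : ∫ p in S, w p ∂(μH[1]) = 0 := setIntegral_sphere_eq_zero hwc fun p hp =>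
    integral_green_planeRotation hV hVball hu0C1 huεC1 hu0harm huεharm hp
  have hwi : IntegrableOn w S μH[1] :=
    hwc.integrableOn_of_subset_isCompact (isCompact_sphere _ _) hSm subset_rfl
      hausdorffMeasure_sphere_lt_top.ne
  have hsplit1 := integral_inter_add_sdiff hΓSm hwi
  have hsplit2 := integral_inter_add_sdiff hΓΔm (hwi.mono_set hΓS)
  rw [Set.inter_eq_right.2 hΓS, setIntegral_eq_zero_of_forall_eq_zero (t := S \ ΓS),
    hflux, add_zero] at hsplit1
  · rw [Set.inter_eq_right.2 hΓΔ, hsplit1,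
      setIntegral_congr_fun (g := fun p => (-lam0) * (u0 p * uε p)) hΓΔm,
      setIntegral_congr_fun (g := fun p => (lamε - lam0) * (u0 p * uε p)) (hΓSm.diff hΓΔm),
      integral_const_mul, integral_const_mul] at hsplit2
    · linarith
    · intro p hp
      simp only [hw, hbc0S p hp.1, hbcεS p hp]
      ring
    · intro p hp
      simp only [hw, hbc0S p (hΓΔ hp), hbcεN p (Or.inr hp)]
      ring
  · intro p hp
    simp [hw, hbc0N p hp, hbcεN p (Or.inl hp)]
end

section
/- Let Γ_S ⊆ S¹ be a Borel measurable subset of the unit circle, let Γ_Δ ⊆ Γ_S be Borel measurable, let λ ∈ ℝ and let x_S ∈ D. Suppose R : ℝ² → ℝ is continuously differentiable on an open neighborhood of the closed unit disk and harmonic on D, and define S : ℝ² \ {x_S} → ℝ by S(y) = (1/(2π))·log‖x_S − y‖ + R(y); assume S satisfies the Steklov-Neumann boundary conditions p · ∇S(p) = λ · S(p) for all p ∈ Γ_S and p · ∇S(p) = 0 for all p ∈ S¹ \ Γ_S. Suppose further u : ℝ² → ℝ is continuously differentiable on an open neighborhood of the closed unit disk, harmonic on D, and satisfies p · ∇u(p)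 = λ · u(p) for all p ∈ Γ_S \ Γ_Δ and p · ∇u(p) = 0 for all p ∈ (S¹ \ Γ_S) ∪ Γ_Δ. Then u(x_S) = λ · ∫_{Γ_Δ} S(p) · u(p) dσ(p). -/
open MeasureTheory Metric

open Filter Topology Set Real InnerProductSpace
open scoped ENNReal NNReal

lemma one_sub_mul_abs_sub_le_norm_circleMap_sub {δ s t : ℝ} (hδ1 : δ ≤ 1)
    (hst : |s - t| ≤ δ) :
    (1 - δ) * |s - t| ≤ ‖circleMap 0 1 s - circleMap 0 1 t‖ := by
  have key : ‖circleMap 0 1 s - circleMap 0 1 t‖ = 2 * |Real.sin ((s - t) / 2)| := by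
    have h : circleMap 0 1 s - circleMap 0 1 t
        = circleMap 0 1 t * (Complex.exp (Complex.I * ((s - t : ℝ) : ℂ)) - 1) := by
      simp only [circleMap, zero_add, Complex.ofReal_one, one_mul, mul_sub, mul_one,
        ← Complex.exp_add]
      congr 2
      push_cast
      ring
    rw [h, norm_mul, norm_circleMap_zero, abs_one, one_mul,
      Complex.norm_exp_I_mul_ofReal_sub_one, Real.norm_eq_abs, abs_mul, abs_two]
  have pos : ∀ x : ℝ, 0 ≤ x → x ≤ δ → (1 - δ) * x ≤ 2 * Real.sin (x / 2) := by
    intro x hx hxδ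
    rcases hx.eq_or_lt with rfl | hx
    · simp
    have := Real.sin_gt_sub_cube (x := x / 2) (by positivity)
    nlinarith [mul_nonneg hx.le (sub_nonneg.2 hxδ), mul_nonneg hx.le hx.le,
      mul_nonneg (mul_nonneg hx.le hx.le) (sub_nonneg.2 (hxδ.trans hδ1))]
  rw [key]
  rcases le_total 0 (s - t) with h | h
  · rw [abs_of_nonneg h] at hst ⊢
    exact (pos _ h hst).trans (by gcongr; exact le_abs_self _)
  · rw [abs_of_nonpos h] at hst ⊢
    refine (pos _ (by linarith) hst).trans ?_
    gcongr
    rw [neg_div, Real.sin_neg]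
    exact neg_le_abs _

lemma injOn_circleMap_Ioc : InjOn (circleMap 0 1) (Ioc 0 (2 * π)) := by
  have h := injOn_circleMap_of_abs_sub_le (a := 0) (b := 2 * π) (c := 0) one_ne_zero
    (by rw [zero_sub, abs_neg, abs_of_pos Real.two_pi_pos])
  rwa [uIoc_of_le Real.two_pi_pos.le] at h

lemma volume_le_mul_hausdorffMeasure_image_circleMap {A : Set ℝ} (hA : MeasurableSet A)
    (hA' : A ⊆ Ioc 0 (2 * π)) {δ : ℝ} (hδ : 0 < δ) (hδ1 : δ < 1) :
    volume A ≤ ENNReal.ofReal (1 - δ)⁻¹ * μH[1] (circleMap 0 1 '' A) := by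
  let A' : ℤ → Set ℝ := fun k ↦ A ∩ Ioc (k • δ) ((k + 1) • δ)
  have hAm : ∀ k, MeasurableSet (A' k) := fun k ↦ hA.inter measurableSet_Ioc
  have hdisj : Pairwise (Function.onFun Disjoint A') := fun i j hij ↦
    (pairwise_disjoint_Ioc_zsmul δ hij).mono inter_subset_right inter_subset_right
  have hU : ⋃ k, A' k = A := by
    rw [← inter_iUnion, iUnion_Ioc_zsmul hδ, inter_univ]
  have hsub : ∀ k, A' k ⊆ Ioc 0 (2 * π) := fun k ↦ inter_subset_left.trans hA'
  have piece : ∀ k, volume (A' k)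
      ≤ ENNReal.ofReal (1 - δ)⁻¹ * μH[1] (circleMap 0 1 '' A' k) := by
    intro k
    have hinj := injOn_circleMap_Ioc.mono (hsub k)
    have hlip : LipschitzOnWith (1 - δ)⁻¹.toNNReal (Function.invFunOn (circleMap 0 1) (A' k))
        (circleMap 0 1 '' A' k) := by
      apply LipschitzOnWith.of_dist_le_mul
      rintro _ ⟨s, hs, rfl⟩ _ ⟨t, ht, rfl⟩
      rw [hinj.leftInvOn_invFunOn hs, hinj.leftInvOn_invFunOn ht, Real.dist_eq, dist_eq_norm,
        Real.coe_toNNReal _ (by rw [inv_nonneg]; linarith)]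
      have h1 := hs.2
      have h2 := ht.2
      simp only [mem_Ioc, zsmul_eq_mul, Int.cast_add, Int.cast_one, add_mul, one_mul] at h1 h2
      have := one_sub_mul_abs_sub_le_norm_circleMap_sub (s := s) (t := t) hδ1.le
        (abs_le.2 ⟨by linarith, by linarith⟩)
      rw [inv_mul_eq_div, le_div_iff₀ (by linarith)]
      linarith
    have := hlip.hausdorffMeasure_image_le zero_le_one
    rw [hinj.leftInvOn_invFunOn.image_image, ENNReal.rpow_one] at this
    rwa [← hausdorffMeasure_real]
  calc volume A = ∑' k, volume (A' k) := by rw [← measure_iUnion hdisj hAm, hU]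
    _ ≤ ∑' k, ENNReal.ofReal (1 - δ)⁻¹ * μH[1] (circleMap 0 1 '' A' k) :=
        ENNReal.tsum_le_tsum piece
    _ = _ := by
        rw [ENNReal.tsum_mul_left, ← measure_iUnion, ← image_iUnion, hU]
        · exact fun i j hij ↦ (hdisj hij).image injOn_circleMap_Ioc (hsub i) (hsub j)
        · exact fun k ↦ (hAm k).image_of_continuousOn_injOn (continuous_circleMap 0 1).continuousOn
            (injOn_circleMap_Ioc.mono (hsub k))

lemma hausdorffMeasure_image_circleMap {A : Set ℝ} (hA : MeasurableSet A)
    (hA' : A ⊆ Ioc 0 (2 * π)) : μH[1] (circleMap 0 1 '' A) = volume A := by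
  apply le_antisymm
  · have := (lipschitzWith_circleMap 0 1).hausdorffMeasure_image_le zero_le_one A
    simpa [hausdorffMeasure_real] using this
  · have hlim : Tendsto (fun δ : ℝ ↦ ENNReal.ofReal (1 - δ)⁻¹ * μH[1] (circleMap 0 1 '' A))
        (𝓝[>] 0) (𝓝 (ENNReal.ofReal (1 - 0)⁻¹ * μH[1] (circleMap 0 1 '' A))) := by
      refine ENNReal.Tendsto.mul_const (ENNReal.tendsto_ofReal ?_) (Or.inl (by simp))
      apply tendsto_nhdsWithin_of_tendsto_nhds
      exact ((continuous_const.sub continuous_id).tendsto 0).inv₀ (by simp)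
    simp only [sub_zero, inv_one, ENNReal.ofReal_one, one_mul] at hlim
    refine ge_of_tendsto hlim ?_
    filter_upwards [Ioo_mem_nhdsGT (zero_lt_one' ℝ)] with δ hδ
    exact volume_le_mul_hausdorffMeasure_image_circleMap hA hA' hδ.1 hδ.2

lemma image_circleMap_preimage_inter {B : Set ℂ} (hB : B ⊆ sphere 0 1) :
    circleMap 0 1 '' (circleMap 0 1 ⁻¹' B ∩ Ioc 0 (2 * π)) = B := by
  rw [image_preimage_inter, image_circleMap_Ioc, abs_one, inter_eq_left]
  exact hB

lemma map_circleMap_volume_restrict :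
    (volume.restrict (Ioc 0 (2 * π))).map (circleMap 0 1)
      = (μH[1] : Measure ℂ).restrict (sphere 0 1) := by
  have hm : Measurable (circleMap 0 1) := (continuous_circleMap 0 1).measurable
  ext B hB
  rw [Measure.map_apply hm hB, Measure.restrict_apply (hm hB), Measure.restrict_apply hB,
    ← image_circleMap_preimage_inter (B := B ∩ sphere 0 1) inter_subset_right,
    hausdorffMeasure_image_circleMap _ inter_subset_right]
  · congr 2
    ext θ
    simp
  · exact (hm (hB.inter isClosed_sphere.measurableSet)).inter measurableSet_Ioc

lemma setIntegral_hausdorffMeasure_eq_intervalIntegral_indicator {Γ : Set ℂ}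
    (hΓ : MeasurableSet Γ) (hΓ' : Γ ⊆ sphere 0 1) {g : ℂ → ℝ} (hg : ContinuousOn g (sphere 0 1)) :
    ∫ z in Γ, g z ∂μH[1] = ∫ θ in 0..2 * π, Γ.indicator g (circleMap 0 1 θ) := by
  rw [intervalIntegral.integral_of_le Real.two_pi_pos.le,
    ← integral_map (f := Γ.indicator g) (continuous_circleMap 0 1).aemeasurable,
    map_circleMap_volume_restrict, integral_indicator hΓ, Measure.restrict_restrict hΓ,
    inter_eq_left.2 hΓ']
  rw [map_circleMap_volume_restrict]
  exact (hg.aestronglyMeasurable isClosed_sphere.measurableSet).indicator hΓ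

open ComplexConjugate in
lemma circleAverage_re_mul_sub_eq_zero {F G : ℂ → ℂ} {r : ℝ}
    (hF : AnalyticOnNhd ℂ F (closedBall 0 |r|)) (hG : AnalyticOnNhd ℂ G (closedBall 0 |r|)) :
    circleAverage (fun z ↦ (F z).re * (z * deriv G z).re - (G z).re * (z * deriv F z).re) 0 r
      = 0 := by
  let D : ℂ → ℂ := fun z ↦ z * (F z * deriv G z - G z * deriv F z)
  let B : ℂ → ℂ := fun z ↦
    Complex.I * (z * deriv F z * conj (G z) - F z * conj (z * deriv G z))
  have hD : AnalyticOnNhd ℂ D (closedBall 0 |r|) :=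
    analyticOnNhd_id.mul ((hF.mul hG.deriv).sub (hG.mul hF.deriv))
  have hBc : ContinuousOn B (closedBall 0 |r|) := by
    have h1 := hF.continuousOn
    have h2 := hG.continuousOn
    have h3 := hF.deriv.continuousOn
    have h4 := hG.deriv.continuousOn
    have hc := Complex.continuous_conj
    exact continuousOn_const.mul (((continuousOn_id.mul h3).mul (hc.comp_continuousOn h2)).sub
      (h1.mul (hc.comp_continuousOn (continuousOn_id.mul h4))))
  have hmem : ∀ θ, circleMap 0 r θ ∈ closedBall (0 : ℂ) |r| := fun θ ↦ by
    simp
  have hDavg : circleAverage (fun z ↦ (D z).re) 0 r = 0 := by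
    rw [InnerProductSpace.HarmonicOnNhd.circleAverage_eq fun z hz ↦ (hD z hz).harmonicAt_re]
    simp [D]
  have hder : ∀ θ, HasDerivAt (fun θ ↦ F (circleMap 0 r θ) * conj (G (circleMap 0 r θ)))
      (B (circleMap 0 r θ)) θ := by
    intro θ
    have h1 := ((hF _ (hmem θ)).differentiableAt.hasDerivAt).comp θ (hasDerivAt_circleMap 0 r θ)
    have h2 := ((hG _ (hmem θ)).differentiableAt.hasDerivAt).comp θ (hasDerivAt_circleMap 0 r θ)
    refine (h1.mul (Complex.conjCLE.hasFDerivAt.comp_hasDerivAt θ h2)).congr_deriv ?_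
    simp [B]
    ring
  have hBavg : circleAverage B 0 r = 0 := by
    rw [circleAverage_def, intervalIntegral.integral_eq_sub_of_hasDerivAt (fun θ _ ↦ hder θ)]
    · have := (periodic_circleMap 0 r) 0
      rw [zero_add] at this
      simp [this]
    · refine (hBc.comp_continuous (continuous_circleMap 0 r) hmem).intervalIntegrable _ _
  have hBi : CircleIntegrable B 0 r := (hBc.mono sphere_subset_closedBall).circleIntegrable'
  have hBavg' : circleAverage (fun z ↦ (B z).im) 0 r = 0 := by
    have := Complex.imCLM.circleAverage_comp_comm hBi
    simpa [hBavg, Function.comp_def] using this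
  have hDi : CircleIntegrable (fun z ↦ (D z).re) 0 r :=
    ((Complex.continuous_re.comp_continuousOn hD.continuousOn).mono
      sphere_subset_closedBall).circleIntegrable'
  have hBi' : CircleIntegrable (fun z ↦ (B z).im) 0 r :=
    ((Complex.continuous_im.comp_continuousOn hBc).mono sphere_subset_closedBall).circleIntegrable'
  have heq : (fun z ↦ (F z).re * (z * deriv G z).re - (G z).re * (z * deriv F z).re)
      = (1 / 2 : ℝ) • ((fun z ↦ (D z).re) - fun z ↦ (B z).im) := by
    ext z
    simp [D, B]
    ring
  rw [heq, circleAverage_smul, circleAverage_sub hDi hBi', hDavg, hBavg']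
  simp

lemma fderiv_re_apply_self {F : ℂ → ℂ} {u : ℂ → ℝ} {z : ℂ} (hF : AnalyticAt ℂ F z)
    (hu : (fun w ↦ (F w).re) =ᶠ[𝓝 z] u) : fderiv ℝ u z z = (z * deriv F z).re := by
  rw [← hu.fderiv_eq]
  have h := Complex.reCLM.hasFDerivAt.comp z
    (hF.differentiableAt.hasDerivAt.hasFDerivAt.restrictScalars ℝ)
  have h' : fderiv ℝ (fun w ↦ (F w).re) z = _ := h.fderiv
  rw [h']
  simp

lemma continuousOn_fderiv_apply_self {u : ℂ → ℝ} {V : Set ℂ} (hV : IsOpen V)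
    (hu : ContDiffOn ℝ 1 u V) : ContinuousOn (fun z ↦ fderiv ℝ u z z) V :=
  (hu.continuousOn_fderiv_of_isOpen hV le_rfl).clm_apply continuousOn_id

/-- Green's second identity on the unit disk for two harmonic functions. -/
lemma circleAverage_green {u v : ℂ → ℝ} {V : Set ℂ} (hV : IsOpen V) (hVball : closedBall 0 1 ⊆ V)
    (huV : ContDiffOn ℝ 1 u V) (hvV : ContDiffOn ℝ 1 v V)
    (hu : HarmonicOnNhd u (ball 0 1)) (hv : HarmonicOnNhd v (ball 0 1)) :
    circleAverage (fun z ↦ u z * fderiv ℝ v z z - v z * fderiv ℝ u z z) 0 1 = 0 := by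
  obtain ⟨F, hF, hFu⟩ := hu.exists_analyticOnNhd_ball_re_eq
  obtain ⟨G, hG, hGv⟩ := hv.exists_analyticOnNhd_ball_re_eq
  have hcont : ContinuousOn (fun z ↦ u z * fderiv ℝ v z z - v z * fderiv ℝ u z z) V :=
    (huV.continuousOn.mul (continuousOn_fderiv_apply_self hV hvV)).sub
      (hvV.continuousOn.mul (continuousOn_fderiv_apply_self hV huV))
  have hcircle : ContinuousOn
      (circleAverage (fun z ↦ u z * fderiv ℝ v z z - v z * fderiv ℝ u z z) 0) (Ioc 0 1) := by
    refine ContinuousOn.circleAverage (hcont.mono fun z hz ↦ hVball ?_) fun r hr ↦ hr.1.le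
    simpa using hz.2
  refine hcircle.eq_of_eqOn_Ioo one_pos fun r hr ↦ ?_
  have hsub : closedBall (0 : ℂ) |r| ⊆ ball 0 1 :=
    closedBall_subset_ball (by rw [abs_of_pos hr.1]; exact hr.2)
  rw [← circleAverage_re_mul_sub_eq_zero (hF.mono hsub) (hG.mono hsub)]
  refine circleAverage_congr_sphere fun z hz ↦ ?_
  have hz' : z ∈ ball (0 : ℂ) 1 := hsub (sphere_subset_closedBall hz)
  have hn := isOpen_ball.mem_nhds hz'
  rw [fderiv_re_apply_self (hF z hz') (hFu.eventuallyEq_of_mem hn),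
    fderiv_re_apply_self (hG z hz') (hGv.eventuallyEq_of_mem hn), ← hFu hz', ← hGv hz']

lemma hasFDerivAt_log_norm {F : ℂ → ℂ} {F' z : ℂ} (hF : HasDerivAt F F' z) (hz : F z ≠ 0) :
    HasFDerivAt (fun w ↦ Real.log ‖F w‖)
      (Complex.reCLM ∘L ((ContinuousLinearMap.toSpanSingleton ℂ (F' / F z)).restrictScalars ℝ))
      z := by
  have h1 : HasDerivAt (fun w ↦ Complex.log (F w / F z)) (F' / F z) z := by
    have := (hF.div_const (F z)).clog (by simp [hz])
    simpa [hz] using this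
  have h2 := (Complex.reCLM.hasFDerivAt.comp z (h1.hasFDerivAt.restrictScalars ℝ)).add_const
    (Real.log ‖F z‖)
  refine h2.congr_of_eventuallyEq ?_
  filter_upwards [hF.continuousAt.eventually_ne hz] with w hw
  simp [Complex.log_re, Real.log_div, hw, hz]

open ComplexConjugate in
lemma norm_sub_eq_norm_one_sub_conj_mul {a z : ℂ} (hz : ‖z‖ = 1) :
    ‖a - z‖ = ‖1 - conj a * z‖ := by
  have h : 1 - conj a * z = z * conj (z - a) := by
    have : z * conj z = 1 := by rw [Complex.mul_conj']; simp [hz]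
    rw [map_sub, mul_sub, this]
    ring
  rw [h, norm_mul, hz, one_mul, RCLike.norm_conj, norm_sub_rev]

open ComplexConjugate in
lemma re_div_sub_eq_add_poissonKernel {a z : ℂ} (hz : ‖z‖ = 1) (ha : ‖a‖ < 1) :
    (z * (-1 / (a - z))).re = (z * (-conj a / (1 - conj a * z))).re + poissonKernel 0 a z := by
  have hN := norm_sub_eq_norm_one_sub_conj_mul (a := a) hz
  have hne : ‖a - z‖ ≠ 0 := by
    rw [norm_ne_zero_iff, sub_ne_zero]
    rintro rfl
    linarith
  have hz2 : z.re * z.re + z.im * z.im = 1 := by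
    rw [← Complex.normSq_apply, Complex.normSq_eq_norm_sq, hz, one_pow]
  have ha2 : ‖a‖ ^ 2 = a.re * a.re + a.im * a.im := by
    rw [← Complex.normSq_apply, Complex.normSq_eq_norm_sq]
  rw [poissonKernel_def, sub_zero, sub_zero, norm_sub_rev z a, hz, ha2, ← mul_div_assoc,
    ← mul_div_assoc, Complex.div_re, Complex.div_re, Complex.normSq_eq_norm_sq,
    Complex.normSq_eq_norm_sq, ← hN]
  field_simp
  simp
  linear_combination (1 - (a.re * a.re + a.im * a.im)) * hz2

/-- Green's representation formula on the unit disk. -/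
lemma intervalIntegral_green_representation {u R S : ℂ → ℝ} {a : ℂ} (ha : a ∈ ball 0 1) {V : Set ℂ}
    (hV : IsOpen V) (hVball : closedBall 0 1 ⊆ V)
    (huV : ContDiffOn ℝ 1 u V) (hRV : ContDiffOn ℝ 1 R V)
    (hu : HarmonicOnNhd u (ball 0 1)) (hR : HarmonicOnNhd R (ball 0 1))
    (hS : ∀ z, z ≠ a → S z = (1 / (2 * π)) * Real.log ‖a - z‖ + R z) :
    ∫ θ in 0..2 * π, (fun z ↦ u z * fderiv ℝ S z z - S z * fderiv ℝ u z z) (circleMap 0 1 θ)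
      = u a := by
  have ha' : ‖a‖ < 1 := by simpa using ha
  let F : ℂ → ℂ := fun z ↦ 1 - (starRingEnd ℂ) a * z
  let L : ℂ → ℝ := fun z ↦ Real.log ‖F z‖
  let v : ℂ → ℝ := fun z ↦ (1 / (2 * π)) • L z + R z
  have hFd : ∀ z, HasDerivAt F (-(starRingEnd ℂ) a) z := fun z ↦ by
    simpa using ((hasDerivAt_id z).const_mul ((starRingEnd ℂ) a)).const_sub 1
  have hFan : ∀ z, AnalyticAt ℂ F z := fun z ↦
    analyticAt_const.sub (analyticAt_const.mul analyticAt_id)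
  have hF0 : ∀ z ∈ closedBall (0 : ℂ) 1, F z ≠ 0 := by
    intro z hz h
    have hz : ‖z‖ ≤ 1 := by simpa using hz
    have h1 : (starRingEnd ℂ) a * z = 1 := (sub_eq_zero.1 h).symm
    have h2 : ‖a‖ * ‖z‖ = 1 := by simpa using congrArg norm h1
    nlinarith [norm_nonneg a]
  have hLh : ∀ z, F z ≠ 0 → HarmonicAt L z := fun z hz ↦ (hFan z).harmonicAt_log_norm hz
  let W : Set ℂ := V ∩ {z | F z ≠ 0}
  have hW : IsOpen W :=
    hV.inter (isOpen_ne.preimage (continuous_iff_continuousAt.2 fun z ↦ (hFd z).continuousAt))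
  have hWball : closedBall 0 1 ⊆ W := fun z hz ↦ ⟨hVball hz, hF0 z hz⟩
  have hLW : ContDiffOn ℝ 1 L W := fun z hz ↦
    ((hLh z hz.2).1.of_le one_le_two).contDiffWithinAt
  have hvW : ContDiffOn ℝ 1 v W := (hLW.const_smul _).add (hRV.mono inter_subset_left)
  have hv : HarmonicOnNhd v (ball 0 1) := fun z hz ↦
    ((hLh z (hF0 z (ball_subset_closedBall hz))).const_smul).add (hR z hz)
  have huW := huV.mono (inter_subset_left : W ⊆ V)
  have hgreen := circleAverage_green hW hWball huW hvW hu hv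
  have hpoisson := HarmonicContOnCl.circleAverage_poissonKernel_smul
    (HarmonicContOnCl.mk_ball hu (huV.continuousOn.mono hVball)) ha
  have hSv : ∀ z ∈ sphere (0 : ℂ) 1, S z = v z ∧
      fderiv ℝ S z z = fderiv ℝ v z z + (1 / (2 * π)) * poissonKernel 0 a z := by
    intro z hz
    have hz1 : ‖z‖ = 1 := by simpa using hz
    have hza : z ≠ a := by rintro rfl; linarith
    have hRd : DifferentiableAt ℝ R z :=
      (hRV.contDiffAt (hV.mem_nhds (hVball (sphere_subset_closedBall hz)))).differentiableAt
        one_ne_zero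
    have hz0 := hF0 z (sphere_subset_closedBall hz)
    refine ⟨?_, ?_⟩
    · rw [hS z hza, norm_sub_eq_norm_one_sub_conj_mul hz1]
      rfl
    · have h1 := ((hasFDerivAt_log_norm ((hasDerivAt_id z).const_sub a)
        (sub_ne_zero.2 hza.symm)).const_mul (1 / (2 * π))).add hRd.hasFDerivAt
      have h2 := ((hasFDerivAt_log_norm (hFd z) hz0).const_smul (1 / (2 * π))).add hRd.hasFDerivAt
      have h3 : fderiv ℝ S z = _ := (h1.congr_of_eventuallyEq
        ((eventually_ne_nhds hza).mono hS)).fderiv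
      have h4 : fderiv ℝ v z = _ := h2.fderiv
      have h5 := re_div_sub_eq_add_poissonKernel hz1 ha'
      rw [h3, h4]
      simp only [_root_.add_apply, _root_.smul_apply,
        ContinuousLinearMap.comp_apply, ContinuousLinearMap.coe_restrictScalars',
        ContinuousLinearMap.toSpanSingleton_apply, Complex.reCLM_apply, smul_eq_mul, id] at h5 ⊢
      rw [h5]
      ring
  have havg : circleAverage (fun z ↦ u z * fderiv ℝ S z z - S z * fderiv ℝ u z z) 0 1
      = (1 / (2 * π)) * u a := by
    have hcongr : circleAverage (fun z ↦ u z * fderiv ℝ S z z - S z * fderiv ℝ u z z) 0 1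
        = circleAverage ((fun z ↦ u z * fderiv ℝ v z z - v z * fderiv ℝ u z z)
          + (1 / (2 * π)) • (poissonKernel 0 a • u)) 0 1 := by
      refine circleAverage_congr_sphere fun z hz ↦ ?_
      rw [abs_one] at hz
      simp only [(hSv z hz).1, (hSv z hz).2, Pi.add_apply, Pi.smul_apply, Pi.mul_apply,
        smul_eq_mul]
      ring
    have hi1 : CircleIntegrable (fun z ↦ u z * fderiv ℝ v z z - v z * fderiv ℝ u z z) 0 1 := by
      refine ContinuousOn.circleIntegrable zero_le_one (ContinuousOn.mono (s := W) ?_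
        (sphere_subset_closedBall.trans hWball))
      exact (huW.continuousOn.mul (continuousOn_fderiv_apply_self hW hvW)).sub
        (hvW.continuousOn.mul (continuousOn_fderiv_apply_self hW huW))
    have hi2 : CircleIntegrable ((1 / (2 * π)) • (poissonKernel 0 a • u)) 0 1 := by
      refine ContinuousOn.circleIntegrable zero_le_one (ContinuousOn.const_smul
        (ContinuousOn.smul ?_ (huV.continuousOn.mono
          (sphere_subset_closedBall.trans hVball))) _)
      intro z hz
      have hza : z - a ≠ 0 := by
        rw [sub_ne_zero]
        rintro rfl
        simp at hz
        linarith
      refine ContinuousAt.continuousWithinAt ?_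
      simp only [funext (poissonKernel_def 0 a), sub_zero]
      exact ContinuousAt.div (by fun_prop) (by fun_prop) (by simpa using hza)
    rw [hcongr, circleAverage_add hi1 hi2, hgreen, circleAverage_smul, hpoisson, zero_add,
      smul_eq_mul]
  rw [circleAverage_def, smul_eq_mul, one_div] at havg
  exact mul_left_cancel₀ (inv_ne_zero Real.two_pi_pos.ne') havg

lemma laplacian_comp_orthonormalBasisOneI_repr {u : EuclideanSpace ℝ (Fin 2) → ℝ} {z : ℂ}
    (hu : ContDiffAt ℝ 2 u (Complex.orthonormalBasisOneI.repr z)) :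
    Laplacian.laplacian (u ∘ Complex.orthonormalBasisOneI.repr) z
      = laplacian2 u (Complex.orthonormalBasisOneI.repr z) := by
  have hd : DifferentiableAt ℝ (fderiv ℝ u) (Complex.orthonormalBasisOneI.repr z) :=
    (hu.fderiv_right (m := 1) (by norm_num)).differentiableAt one_ne_zero
  have hcomp : fderiv ℝ (u ∘ Complex.orthonormalBasisOneI.repr) = fun w ↦
      (fderiv ℝ u (Complex.orthonormalBasisOneI.repr w)).comp
        (Complex.orthonormalBasisOneI.repr.toContinuousLinearEquiv : ℂ →L[ℝ] _) :=
    funext fun w ↦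
      Complex.orthonormalBasisOneI.repr.toContinuousLinearEquiv.comp_right_fderiv
  rw [laplacian_eq_iteratedFDeriv_orthonormalBasis _ Complex.orthonormalBasisOneI, laplacian2]
  refine Finset.sum_congr rfl fun i _ ↦ ?_
  have h1 := (hd.hasFDerivAt.comp z
    Complex.orthonormalBasisOneI.repr.toContinuousLinearEquiv.hasFDerivAt).clm_comp
    (hasFDerivAt_const
      (Complex.orthonormalBasisOneI.repr.toContinuousLinearEquiv : ℂ →L[ℝ] _) z)
  have h2 := hd.hasFDerivAt.clm_apply
    (hasFDerivAt_const (EuclideanSpace.single i (1 : ℝ)) (Complex.orthonormalBasisOneI.repr z))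
  rw [iteratedFDeriv_two_apply, hcomp, h2.fderiv]
  erw [h1.fderiv]
  have hb : Complex.orthonormalBasisOneI.repr (![1, Complex.I] i) = EuclideanSpace.single i 1 := by
    rw [← Complex.coe_orthonormalBasisOneI]
    exact Complex.orthonormalBasisOneI.repr_self i
  simp [hb]

lemma IsHarmonicOn.harmonicOnNhd_comp {u : EuclideanSpace ℝ (Fin 2) → ℝ}
    (hu : IsHarmonicOn u (ball 0 1)) :
    HarmonicOnNhd (u ∘ Complex.orthonormalBasisOneI.repr) (ball 0 1) := by
  have hmem : ∀ z ∈ ball (0 : ℂ) 1,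
      Complex.orthonormalBasisOneI.repr z ∈ ball (0 : EuclideanSpace ℝ (Fin 2)) 1 := by
    intro z hz
    simpa using hz
  have hcd : ∀ z ∈ ball (0 : ℂ) 1, ContDiffAt ℝ 2 u (Complex.orthonormalBasisOneI.repr z) :=
    fun z hz ↦ hu.1.contDiffAt (isOpen_ball.mem_nhds (hmem z hz))
  intro z hz
  refine ⟨(hcd z hz).comp z Complex.orthonormalBasisOneI.repr.contDiff.contDiffAt, ?_⟩
  filter_upwards [isOpen_ball.mem_nhds hz] with w hw
  rw [laplacian_comp_orthonormalBasisOneI_repr (hcd w hw), hu.2 _ (hmem w hw), Pi.zero_apply]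

/-- Representation formula for a perturbed eigenfunction via the unperturbed
Steklov–Neumann Green's function of the unit disk: if `S = (1/(2π))·log‖x_S - ·‖ + R`
(with `R` harmonic) satisfies the Steklov–Neumann boundary conditions for the partition
`(Γ_S, S¹ \ Γ_S)` with parameter `λ`, and `u` is harmonic with the boundary conditions of
the perturbed partition `(Γ_S \ Γ_Δ, (S¹ \ Γ_S) ∪ Γ_Δ)` and eigenvalue `λ`, then
`u(x_S) = λ ∫_{Γ_Δ} S u dσ`, where `σ = μH[1]` is the one-dimensional Hausdorff measure. -/
theorem eigenfunction_representation
    (ΓS ΓΔ : Set (EuclideanSpace ℝ (Fin 2)))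
    (hΓSm : MeasurableSet ΓS) (hΓS : ΓS ⊆ sphere (0 : EuclideanSpace ℝ (Fin 2)) 1)
    (hΓΔm : MeasurableSet ΓΔ) (hΓΔ : ΓΔ ⊆ ΓS)
    (lam : ℝ) (xS : EuclideanSpace ℝ (Fin 2))
    (hxS : xS ∈ ball (0 : EuclideanSpace ℝ (Fin 2)) 1)
    (R : EuclideanSpace ℝ (Fin 2) → ℝ)
    (V : Set (EuclideanSpace ℝ (Fin 2))) (hV : IsOpen V)
    (hVball : closedBall (0 : EuclideanSpace ℝ (Fin 2)) 1 ⊆ V)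
    (hRC1 : ContDiffOn ℝ 1 R V)
    (hRharm : IsHarmonicOn R (ball (0 : EuclideanSpace ℝ (Fin 2)) 1))
    (S : EuclideanSpace ℝ (Fin 2) → ℝ)
    (hS : ∀ z, z ≠ xS → S z = (1 / (2 * Real.pi)) * Real.log ‖xS - z‖ + R z)
    (hSbcS : ∀ p ∈ ΓS, fderiv ℝ S p p = lam * S p)
    (hSbcN : ∀ p ∈ sphere (0 : EuclideanSpace ℝ (Fin 2)) 1 \ ΓS, fderiv ℝ S p p = 0)
    (u : EuclideanSpace ℝ (Fin 2) → ℝ)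
    (huC1 : ContDiffOn ℝ 1 u V)
    (huharm : IsHarmonicOn u (ball (0 : EuclideanSpace ℝ (Fin 2)) 1))
    (hubcS : ∀ p ∈ ΓS \ ΓΔ, fderiv ℝ u p p = lam * u p)
    (hubcN : ∀ p ∈ (sphere (0 : EuclideanSpace ℝ (Fin 2)) 1 \ ΓS) ∪ ΓΔ,
      fderiv ℝ u p p = 0) :
    u xS = lam * ∫ p in ΓΔ, S p * u p ∂(μH[1]) := by
  let e : ℂ ≃ₗᵢ[ℝ] EuclideanSpace ℝ (Fin 2) := Complex.orthonormalBasisOneI.repr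
  obtain ⟨a, rfl⟩ := e.surjective xS
  have ha : a ∈ ball (0 : ℂ) 1 := by simpa using hxS
  have hsphere : ∀ z, z ∈ sphere (0 : ℂ) 1 ↔ e z ∈ sphere 0 1 := fun z ↦ by simp
  have hball : closedBall (0 : ℂ) 1 ⊆ e ⁻¹' V := fun z hz ↦ hVball (by simpa using hz)
  have hfd : ∀ (f : EuclideanSpace ℝ (Fin 2) → ℝ) (z : ℂ),
      fderiv ℝ (f ∘ e) z z = fderiv ℝ f (e z) (e z) := fun f z ↦ by
    have h : fderiv ℝ (f ∘ e) z = _ := e.toContinuousLinearEquiv.comp_right_fderiv (f := f)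
    rw [h]
    rfl
  have hC1 : ∀ {f : EuclideanSpace ℝ (Fin 2) → ℝ}, ContDiffOn ℝ 1 f V →
      ContDiffOn ℝ 1 (f ∘ e) (e ⁻¹' V) := fun hf ↦
    hf.comp e.contDiff.contDiffOn (mapsTo_preimage _ _)
  have hSe : ∀ z, z ≠ a → (S ∘ e) z = (1 / (2 * π)) * Real.log ‖a - z‖ + (R ∘ e) z := by
    intro z hz
    rw [Function.comp_apply, hS _ (e.injective.ne hz), ← map_sub, e.norm_map, Function.comp_apply]
  have hrep := intervalIntegral_green_representation ha (hV.preimage e.continuous) hball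
    (hC1 huC1) (hC1 hRC1) huharm.harmonicOnNhd_comp hRharm.harmonicOnNhd_comp hSe
  have hcont : ContinuousOn (fun z ↦ S (e z) * u (e z)) (sphere 0 1) := by
    have hsub := sphere_subset_closedBall.trans hball
    refine ContinuousOn.mul ?_ ((hC1 huC1).continuousOn.mono hsub)
    have hne : ∀ z ∈ sphere (0 : ℂ) 1, z ≠ a := by
      rintro z hz rfl
      exact (mem_ball.1 ha).ne hz
    refine ContinuousOn.congr ?_ fun z hz ↦ hSe z (hne z hz)
    refine ContinuousOn.add (continuousOn_const.mul (ContinuousOn.log (by fun_prop) ?_))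
      ((hC1 hRC1).continuousOn.mono hsub)
    exact fun z hz ↦ norm_ne_zero_iff.2 (sub_ne_zero.2 (hne z hz).symm)
  rw [← (e.toIsometryEquiv.measurePreserving_hausdorffMeasure 1).setIntegral_preimage_emb
    e.toHomeomorph.measurableEmbedding]
  change u (e a) = lam * ∫ z in e ⁻¹' ΓΔ, S (e z) * u (e z) ∂μH[1]
  rw [setIntegral_hausdorffMeasure_eq_intervalIntegral_indicator
    (e.continuous.measurable hΓΔm) (fun z hz ↦ (hsphere z).2 (hΓS (hΓΔ hz))) hcont,
    ← intervalIntegral.integral_const_mul]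
  refine hrep.symm.trans (intervalIntegral.integral_congr fun θ _ ↦ ?_)
  have hz := circleMap_mem_sphere 0 zero_le_one θ
  generalize circleMap 0 1 θ = z at hz
  rw [hsphere] at hz
  simp only [hfd, Function.comp_apply]
  by_cases hΔ : e z ∈ ΓΔ
  · rw [indicator_of_mem (show z ∈ e ⁻¹' ΓΔ from hΔ), hSbcS _ (hΓΔ hΔ), hubcN _ (Or.inr hΔ)]
    ring
  · rw [indicator_of_notMem (show z ∉ e ⁻¹' ΓΔ from hΔ)]
    by_cases hΓ : e z ∈ ΓS
    · rw [hSbcS _ hΓ, hubcS _ ⟨hΓ, hΔ⟩]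
      ring
    · rw [hSbcN _ ⟨hz, hΓ⟩, hubcN _ (Or.inl ⟨hz, hΓ⟩)]
      ring
end
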